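/- Let H = (X, Y) be a hypergraph with vertex set X and hyperedge set Y whose associated bipartite graph is connected, fix two distinct hyperedges y₁, y₂ ∈ Y, suppose some vertex x ∈ X is incident to both y₁ and y₂, and let H' = (X ∪ {x*}, Y) be obtained from H by adjoining one new vertex x* incident to exactly y₁ and y₂. Then the hypertree sets satisfy Q_{H'} = (Q_H + 1_{y₁}) ∪ (Q_H + 1_{y₂}), i.e., a function g : Y → ℕ is a hypertree of H' if and only if g = f + 1_{y₁} or g = f + 1_{y₂} for some hypertree f of H. -/

import Mathlib

open SimpleGraph

/-- The bipartite graph associated to a hypergraph with hyperedge set `Y`,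
vertex set `X`, and incidence function `I`. -/
def bip {X Y : Type*} (I : Y → Finset X) : SimpleGraph (Y ⊕ X) :=
  SimpleGraph.fromRel fun a b =>
    ∃ y x, a = Sum.inl y ∧ b = Sum.inr x ∧ x ∈ I y

/-- `f : Y → ℕ` is a hypertree: there is a spanning tree of `bip I` whose
degree at each `y ∈ Y` is `f y + 1`. -/
def IsHypertree {X Y : Type*} (I : Y → Finset X) (f : Y → ℕ) : Prop :=
  ∃ T : SimpleGraph (Y ⊕ X), T ≤ bip I ∧ T.IsTree ∧
    ∀ y : Y, (T.neighborSet (Sum.inl y)).ncard = f y + 1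

/-- The incidence function of the hypergraph `H' = (X ∪ {x*}, Y)` obtained by
adjoining one new vertex `x* = none` incident to exactly `y₁` and `y₂`. -/
def extInc {X Y : Type*} [DecidableEq X] [DecidableEq Y] (I : Y → Finset X)
    (y₁ y₂ : Y) : Y → Finset (Option X) :=
  fun y => (I y).map Function.Embedding.some ∪
    (if y = y₁ ∨ y = y₂ then {none} else ∅)

namespace SimpleGraph

variable {V W : Type*}

lemma Reachable.of_forall_adj {G : SimpleGraph V} {H : SimpleGraph W} (r : V → W)
    (hr : ∀ ⦃v w⦄, G.Adj v w → H.Reachable (r v) (r w)) {v w : V} (h : G.Reachable v w) :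
    H.Reachable (r v) (r w) := by
  obtain ⟨p⟩ := h
  induction p with
  | nil => rfl
  | cons hvw _ ih => exact (hr hvw).trans ih

/-- Replacing an edge `s(v, u)` of a tree by an edge joining `u` to another vertex of the
component of `v` yields a tree. -/
lemma IsTree.deleteEdges_sup_edge {G : SimpleGraph V} (hG : G.IsTree) {v u x : V}
    (hadj : G.Adj v u) (h : (G.deleteEdges {s(v, u)}).Reachable v x) :
    (G.deleteEdges {s(v, u)} ⊔ edge x u).IsTree := by
  have hbr := isBridge_iff.1 (isAcyclic_iff_forall_adj_isBridge.1 hG.isAcyclic hadj)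
  have hxu : ¬ (G.deleteEdges {s(v, u)}).Reachable x u := fun h' ↦ hbr (h.trans h')
  have hne : x ≠ u := by rintro rfl; exact hxu .rfl
  have hvu : (G.deleteEdges {s(v, u)} ⊔ edge x u).Reachable v u :=
    (h.mono le_sup_left).trans (Adj.reachable (by simp [edge_adj, hne]))
  have := hG.connected.nonempty
  refine ⟨⟨fun a b ↦ ?_⟩, .sup_edge_of_not_reachable hxu (hG.isAcyclic.anti (deleteEdges_le _))⟩
  refine (hG.connected a b).of_forall_adj id fun c d hcd ↦ ?_
  by_cases hs : s(c, d) = s(v, u)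
  · rcases Sym2.eq_iff.1 hs with ⟨rfl, rfl⟩ | ⟨rfl, rfl⟩
    exacts [hvu, hvu.symm]
  · exact Adj.reachable (.inl (by simpa [deleteEdges_adj, hcd] using hs))

/-- At most one edge at `v` separates `v` from a given vertex `x`. -/
lemma Connected.reachable_deleteEdges_or {G : SimpleGraph V} (hG : G.Connected) {u₁ u₂ : V}
    (hne : u₁ ≠ u₂) (v x : V) :
    (G.deleteEdges {s(v, u₁)}).Reachable v x ∨ (G.deleteEdges {s(v, u₂)}).Reachable v x := by
  obtain ⟨p, hp⟩ := hG.preconnected.exists_isPath v x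
  by_cases hm : s(v, u₁) ∈ p.edges
  · refine .inr ⟨p.toDeleteEdge _ fun hm' ↦ hne ?_⟩
    rw [hp.eq_snd_of_mem_edges hm, hp.eq_snd_of_mem_edges hm']
  · exact .inl ⟨p.toDeleteEdge _ hm⟩

section Pendant

variable {G : SimpleGraph W} {e : V ↪ W} {z : W} {u : V}

/-- Removing a pendant vertex `z` does not affect being a tree. -/
lemma isTree_iff_isTree_comap_of_pendant (hz : ∀ w, w ≠ z ↔ w ∈ Set.range e)
    (hadj : ∀ w, G.Adj z w ↔ w = e u) : G.IsTree ↔ (G.comap e).IsTree := by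
  classical
  have hez (v : V) : e v ≠ z := (hz _).2 ⟨v, rfl⟩
  let r (w : W) : V := if h : w = z then u else ((hz w).1 h).choose
  have hrz : r z = u := by simp [r]
  have hre (v : V) : r (e v) = v := by
    have h : r (e v) = ((hz (e v)).1 (hez v)).choose := by simp [r, hez]
    rw [h]
    exact e.injective ((hz (e v)).1 (hez v)).choose_spec
  have hcases (w : W) : w = z ∨ ∃ v, w = e v :=
    or_iff_not_imp_left.2 fun h ↦ ((hz w).1 h).imp fun _ ↦ Eq.symm
  have hr {v w : W} (h : G.Adj v w) : (G.comap e).Reachable (r v) (r w) := by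
    rcases hcases v with rfl | ⟨v, rfl⟩
    · rw [(hadj w).1 h, hrz, hre]
    rcases hcases w with rfl | ⟨w, rfl⟩
    · rw [(hadj _).1 h.symm, hrz, hre]
    · rw [hre, hre]
      exact Adj.reachable h
  refine ⟨fun hG ↦ ?_, fun hG ↦ ?_⟩
  · have : Nonempty V := ⟨u⟩
    refine ⟨⟨fun a b ↦ ?_⟩, hG.isAcyclic.of_comap e⟩
    simpa [hre] using (hG.connected (e a) (e b)).of_forall_adj r @hr
  · have : Nonempty W := ⟨z⟩
    have hzr (w : W) : G.Reachable w (e (r w)) := by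
      rcases hcases w with rfl | ⟨v, rfl⟩
      · exact Adj.reachable ((hadj _).2 (by rw [hrz]))
      · rw [hre]
    have hconn (v w : W) : G.Reachable v w :=
      (hzr v).trans <| ((hG.connected (r v) (r w)).of_forall_adj e
        fun _ _ h ↦ Adj.reachable h).trans (hzr w).symm
    refine ⟨⟨hconn⟩, isAcyclic_iff_forall_adj_isBridge.2 ?_⟩
    have hbr : G.IsBridge s(z, e u) := by
      rw [isBridge_iff]
      rintro ⟨p⟩
      cases p with
      | nil => exact hez u rfl
      | cons h _ =>
        rw [deleteEdges_adj, hadj] at h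
        simp [h.1] at h
    intro v w h
    rcases hcases v with rfl | ⟨v, rfl⟩
    · rwa [(hadj w).1 h]
    rcases hcases w with rfl | ⟨w, rfl⟩
    · rwa [(hadj _).1 h.symm, Sym2.eq_swap]
    · rw [isBridge_iff]
      intro hvw
      refine isBridge_iff.1 (isAcyclic_iff_forall_adj_isBridge.1 hG.isAcyclic
        (v := v) (w := w) h) ?_
      have := hvw.of_forall_adj (H := (G.comap e).deleteEdges {s(v, w)}) r fun a b hab ↦ ?_
      · simpa [hre] using this
      rw [deleteEdges_adj] at hab
      rcases hcases a with rfl | ⟨a, rfl⟩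
      · rw [(hadj b).1 hab.1, hrz, hre]
      rcases hcases b with rfl | ⟨b, rfl⟩
      · rw [(hadj _).1 hab.1.symm, hrz, hre]
      · rw [hre, hre]
        refine Adj.reachable (deleteEdges_adj.2 ⟨hab.1, fun hs ↦ hab.2 ?_⟩)
        simpa using congrArg (Sym2.map e) hs

lemma ncard_neighborSet_of_pendant [Finite W] [DecidableEq V]
    (hz : ∀ w, w ≠ z ↔ w ∈ Set.range e) (hadj : ∀ w, G.Adj z w ↔ w = e u) (v : V) :
    (G.neighborSet (e v)).ncard =
      ((G.comap e).neighborSet v).ncard + if v = u then 1 else 0 := by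
  have hmem : z ∈ G.neighborSet (e v) ↔ v = u := by
    rw [mem_neighborSet, adj_comm, hadj, e.injective.eq_iff]
  have himage : e '' (G.comap e).neighborSet v = G.neighborSet (e v) \ {z} := by
    ext w
    simp only [Set.mem_image, mem_neighborSet, comap_adj, Set.mem_sdiff, Set.mem_singleton_iff, hz]
    constructor
    · rintro ⟨a, ha, rfl⟩
      exact ⟨ha, a, rfl⟩
    · rintro ⟨ha, a, rfl⟩
      exact ⟨a, ha, rfl⟩
  rw [← Set.ncard_image_of_injective _ e.injective, himage]
  split_ifs with h
  · exact (Set.ncard_sdiff_singleton_add_one (hmem.2 h)).symm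
  · rw [Set.sdiff_singleton_eq_self (hmem.not.2 h), add_zero]

end Pendant

end SimpleGraph

section Hypertree

variable {X Y : Type*}

@[simp] lemma bip_adj_inl_inr (I : Y → Finset X) (y : Y) (x : X) :
    (bip I).Adj (.inl y) (.inr x) ↔ x ∈ I y := by
  simp [bip]

@[simp] lemma bip_adj_inr_inl (I : Y → Finset X) (y : Y) (x : X) :
    (bip I).Adj (.inr x) (.inl y) ↔ x ∈ I y := by
  simp [bip]

@[simp] lemma not_bip_adj_inl_inl (I : Y → Finset X) (y y' : Y) :
    ¬ (bip I).Adj (.inl y) (.inl y') := by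
  simp [bip]

@[simp] lemma not_bip_adj_inr_inr (I : Y → Finset X) (x x' : X) :
    ¬ (bip I).Adj (.inr x) (.inr x') := by
  simp [bip]

/-- The inclusion of the vertices of `bip I` into those of `bip (extInc I y₁ y₂)`. -/
def extEmb (X Y : Type*) : Y ⊕ X ↪ Y ⊕ Option X :=
  (Function.Embedding.refl Y).sumMap Function.Embedding.some

@[simp] lemma extEmb_inl (y : Y) : extEmb X Y (.inl y) = .inl y := rfl

@[simp] lemma extEmb_inr (x : X) : extEmb X Y (.inr x) = .inr (some x) := rfl

lemma ne_inr_none_iff_mem_range_extEmb (w : Y ⊕ Option X) :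
    w ≠ .inr none ↔ w ∈ Set.range (extEmb X Y) := by
  rcases w with y | _ | x <;> simp

variable [DecidableEq X] [DecidableEq Y]

@[simp] lemma some_mem_extInc (I : Y → Finset X) (y₁ y₂ y : Y) (x : X) :
    some x ∈ extInc I y₁ y₂ y ↔ x ∈ I y := by
  unfold extInc
  split_ifs <;> simp

@[simp] lemma none_mem_extInc (I : Y → Finset X) (y₁ y₂ y : Y) :
    none ∈ extInc I y₁ y₂ y ↔ y = y₁ ∨ y = y₂ := by
  unfold extInc
  split_ifs with h <;> simp [h]

lemma extInc_comm (I : Y → Finset X) (y₁ y₂ : Y) : extInc I y₁ y₂ = extInc I y₂ y₁ := by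
  unfold extInc
  simp only [or_comm]

lemma comap_bip_extInc (I : Y → Finset X) (y₁ y₂ : Y) :
    (bip (extInc I y₁ y₂)).comap (extEmb X Y) = bip I := by
  ext (y | x) (y' | x') <;> simp

/-- Attaching the new vertex as a leaf to `y₁` turns a hypertree `f` into `f + 1_{y₁}`. -/
lemma IsHypertree.extInc_add [Finite X] [Finite Y] {I : Y → Finset X} {f : Y → ℕ}
    (hf : IsHypertree I f) (y₁ y₂ : Y) :
    IsHypertree (extInc I y₁ y₂) fun y ↦ f y + if y = y₁ then 1 else 0 := by
  obtain ⟨T, hTI, hT, hdeg⟩ := hf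
  let G := T.map (extEmb X Y) ⊔ edge (.inr none) (.inl y₁)
  have hadj (w) : G.Adj (.inr none) w ↔ w = extEmb X Y (.inl y₁) := by
    have : ¬ (T.map (extEmb X Y)).Adj (.inr none) w := by
      rintro ⟨-, a, b, -, ha, -⟩
      exact (ne_inr_none_iff_mem_range_extEmb _).2 ⟨a, ha⟩ rfl
    simp only [G, sup_adj, this, edge_adj, false_or]
    aesop
  have hcomap : G.comap (extEmb X Y) = T := by
    ext a b
    have hne (a) : extEmb X Y a ≠ .inr none := (ne_inr_none_iff_mem_range_extEmb _).2 ⟨a, rfl⟩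
    simp [G, edge_adj, hne]
  refine ⟨G, sup_le (map_le_iff_le_comap _ _ _ |>.2 (by rwa [comap_bip_extInc])) ?_,
    (isTree_iff_isTree_comap_of_pendant ne_inr_none_iff_mem_range_extEmb hadj).2 (by rwa [hcomap]),
    fun y ↦ ?_⟩
  · rw [edge_le_iff]
    simp
  · have := ncard_neighborSet_of_pendant ne_inr_none_iff_mem_range_extEmb hadj (.inl y)
    rw [hcomap, hdeg] at this
    simp only [extEmb_inl, Sum.inl.injEq] at this
    rw [this]
    exact Nat.add_right_comm ..

/-- If the new vertex is a leaf attached to `y₀`, then deleting it yields a hypertree `g - 1_{y₀}`. -/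
lemma IsHypertree.exists_of_pendant [Finite X] [Finite Y] [Nonempty X] {I : Y → Finset X}
    {g : Y → ℕ} {y₁ y₂ y₀ : Y} {T : SimpleGraph (Y ⊕ Option X)} (hTI : T ≤ bip (extInc I y₁ y₂))
    (hT : T.IsTree) (hdeg : ∀ y, (T.neighborSet (.inl y)).ncard = g y + 1)
    (hadj : ∀ w, T.Adj (.inr none) w ↔ w = .inl y₀) :
    ∃ f, IsHypertree I f ∧ g = fun y ↦ f y + if y = y₀ then 1 else 0 := by
  rw [← extEmb_inl] at hadj
  have hT' := (isTree_iff_isTree_comap_of_pendant ne_inr_none_iff_mem_range_extEmb hadj).1 hT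
  have hcard (y : Y) : 0 < ((T.comap (extEmb X Y)).neighborSet (.inl y)).ncard := by
    have : Nontrivial (Y ⊕ X) := ⟨.inl y, .inr (Classical.arbitrary X), by simp⟩
    exact (Set.ncard_pos (Set.toFinite _)).2
      (hT'.connected.preconnected.exists_adj_of_nontrivial (.inl y))
  refine ⟨fun y ↦ ((T.comap (extEmb X Y)).neighborSet (.inl y)).ncard - 1,
    ⟨_, ?_, hT', fun y ↦ (Nat.sub_add_cancel (hcard y)).symm⟩, funext fun y ↦ ?_⟩
  · rw [← comap_bip_extInc I y₁ y₂]
    exact comap_monotone _ hTI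
  · have := ncard_neighborSet_of_pendant ne_inr_none_iff_mem_range_extEmb hadj (.inl y)
    simp only [extEmb_inl, hdeg, Sum.inl.injEq] at this
    have := hcard y
    dsimp only
    omega

/-- If the new vertex `x*` has degree two and `x` lies on its side of the edge to `y₂`, then this
edge can be exchanged for one joining `x` and `y₂`. -/
lemma IsHypertree.exists_of_reachable [Finite X] [Finite Y] {I : Y → Finset X}
    {g : Y → ℕ} {y₁ y₂ : Y} (hy : y₁ ≠ y₂) {x : X} (hx : x ∈ I y₂)
    {T : SimpleGraph (Y ⊕ Option X)} (hTI : T ≤ bip (extInc I y₁ y₂))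
    (hT : T.IsTree) (hdeg : ∀ y, (T.neighborSet (.inl y)).ncard = g y + 1)
    (h₁ : T.Adj (.inr none) (.inl y₁)) (h₂ : T.Adj (.inr none) (.inl y₂))
    (h : (T.deleteEdges {s(.inr none, .inl y₂)}).Reachable (.inr none) (.inr (some x))) :
    ∃ f, IsHypertree I f ∧ g = fun y ↦ f y + if y = y₁ then 1 else 0 := by
  have : Nonempty X := ⟨x⟩
  have hnadj : ¬ T.Adj (.inl y₂) (.inr (some x)) := fun h' ↦
    isBridge_iff.1 (isAcyclic_iff_forall_adj_isBridge.1 hT.isAcyclic h₂) <|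
      h.trans (Adj.reachable (by simp [deleteEdges_adj, h'.symm]))
  refine exists_of_pendant (y₁ := y₁) (y₂ := y₂) (y₀ := y₁) ?_ (hT.deleteEdges_sup_edge h₂ h)
    (fun y ↦ ?_) fun w ↦ ?_
  · refine sup_le ((deleteEdges_le _).trans hTI) ?_
    rw [edge_le_iff]
    simp [hx]
  · rw [← hdeg]
    by_cases hyy : y = y₂
    · subst hyy
      have : (T.deleteEdges {s(.inr none, .inl y)} ⊔ edge (.inr (some x)) (.inl y)).neighborSet
          (.inl y) = insert (.inr (some x)) (T.neighborSet (.inl y) \ {.inr none}) := by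
        ext w
        simp only [mem_neighborSet, sup_adj, deleteEdges_adj, edge_adj, Set.mem_insert_iff,
          Set.mem_sdiff, Set.mem_singleton_iff]
        aesop
      rw [this, Set.ncard_insert_of_notMem (by simp [hnadj]),
        Set.ncard_sdiff_singleton_add_one (by exact h₂.symm)]
    · congr 1
      ext w
      simp only [mem_neighborSet, sup_adj, deleteEdges_adj, edge_adj]
      aesop
  · constructor
    · intro hw
      rcases hw with hw | hw
      · rw [deleteEdges_adj] at hw
        have := hTI hw.1
        rcases w with y | x'
        · simp at this
          aesop
        · simp at this
      · simp [edge_adj] at hw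
    · rintro rfl
      left
      simp [deleteEdges_adj, h₁, hy]

end Hypertree

/-- If some vertex `x ∈ X` is incident to both `y₁` and `y₂`, then
`Q_{H'} = (Q_H + 1_{y₁}) ∪ (Q_H + 1_{y₂})`: a function `g : Y → ℕ` is a
hypertree of `H'` iff it is `f + 1_{y₁}` or `f + 1_{y₂}` for a hypertree
`f` of `H`. -/
theorem extInc_hypertreeSet {X Y : Type*} [Fintype X] [Fintype Y]
    [DecidableEq X] [DecidableEq Y] (I : Y → Finset X)
    (hne : ∀ y, (I y).Nonempty) (hconn : (bip I).Connected)
    (y₁ y₂ : Y) (hy : y₁ ≠ y₂) (hx : ∃ x, x ∈ I y₁ ∧ x ∈ I y₂)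
    (g : Y → ℕ) :
    IsHypertree (extInc I y₁ y₂) g ↔
      ∃ f : Y → ℕ, IsHypertree I f ∧
        (g = (fun y => f y + if y = y₁ then 1 else 0) ∨
         g = (fun y => f y + if y = y₂ then 1 else 0)) := by
  obtain ⟨x, hx₁, hx₂⟩ := hx
  have : Nonempty X := ⟨x⟩
  constructor
  · rintro ⟨T, hTI, hT, hdeg⟩
    have hnone {w} (hw : T.Adj (.inr none) w) : w = .inl y₁ ∨ w = .inl y₂ := by
      have := hTI hw
      rcases w with y | x'
      · simpa using this
      · simp at this
    by_cases h₁ : T.Adj (.inr none) (.inl y₁) <;> by_cases h₂ : T.Adj (.inr none) (.inl y₂)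
    · rcases hT.connected.reachable_deleteEdges_or (Sum.inl_injective.ne hy)
          (.inr none) (.inr (some x)) with h | h
      · rw [extInc_comm] at hTI
        obtain ⟨f, hf, hg⟩ :=
          IsHypertree.exists_of_reachable hy.symm hx₁ hTI hT hdeg h₂ h₁ h
        exact ⟨f, hf, .inr hg⟩
      · obtain ⟨f, hf, hg⟩ := IsHypertree.exists_of_reachable hy hx₂ hTI hT hdeg h₁ h₂ h
        exact ⟨f, hf, .inl hg⟩
    · obtain ⟨f, hf, hg⟩ := IsHypertree.exists_of_pendant hTI hT hdeg (y₀ := y₁)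
        fun w ↦ ⟨fun hw ↦ (hnone hw).resolve_right (by rintro rfl; exact h₂ hw),
          by rintro rfl; exact h₁⟩
      exact ⟨f, hf, .inl hg⟩
    · obtain ⟨f, hf, hg⟩ := IsHypertree.exists_of_pendant hTI hT hdeg (y₀ := y₂)
        fun w ↦ ⟨fun hw ↦ (hnone hw).resolve_left (by rintro rfl; exact h₁ hw),
          by rintro rfl; exact h₂⟩
      exact ⟨f, hf, .inr hg⟩
    · have : Nontrivial (Y ⊕ Option X) := ⟨.inl y₁, .inr none, by simp⟩
      obtain ⟨w, hw⟩ := hT.connected.preconnected.exists_adj_of_nontrivial (.inr none)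
      rcases hnone hw with rfl | rfl
      exacts [(h₁ hw).elim, (h₂ hw).elim]
  · rintro ⟨f, hf, rfl | rfl⟩
    · exact hf.extInc_add y₁ y₂
    · rw [extInc_comm]
      exact hf.extInc_add y₂ y₁
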